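/- In a finite-dimensional power-commutative real division algebra A, every set of mutually commuting idempotents spans a commutative subalgebra of A. In particular, at most two linearly independent idempotents of A can commute with each other. -/

import Mathlib

open Module

section Defs

variable {A : Type*} [AddCommGroup A] [Module ℝ A]

/-- A linear subspace closed under the multiplication `m`. -/
def IsSubalg (m : A →ₗ[ℝ] A →ₗ[ℝ] A) (U : Submodule ℝ A) : Prop :=
  ∀ x ∈ U, ∀ y ∈ U, m x y ∈ U

/-- The subalgebra generated by a set `s`: the smallest subspace containing `s`
and closed under multiplication. -/
def genSubalg (m : A →ₗ[ℝ] A →ₗ[ℝ] A) (s : Set A) : Submodule ℝ A :=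
  sInf {U : Submodule ℝ A | IsSubalg m U ∧ s ⊆ (U : Set A)}

/-- `m` is a division-algebra multiplication: for nonzero `a`, both left and
right multiplication by `a` are bijective. -/
def IsDivision (m : A →ₗ[ℝ] A →ₗ[ℝ] A) : Prop :=
  ∀ a : A, a ≠ 0 →
    Function.Bijective (fun x : A => m a x) ∧ Function.Bijective (fun x : A => m x a)

/-- Power-commutativity: every subalgebra generated by a single element is commutative. -/
def PowerComm (m : A →ₗ[ℝ] A →ₗ[ℝ] A) : Prop :=
  ∀ x : A, ∀ a ∈ genSubalg m {x}, ∀ b ∈ genSubalg m {x}, m a b = m b a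

/-- An omnipresent idempotent: a nonzero idempotent contained in every
two-dimensional subalgebra. -/
def Omnipresent (m : A →ₗ[ℝ] A →ₗ[ℝ] A) (e : A) : Prop :=
  e ≠ 0 ∧ m e e = e ∧
    ∀ U : Submodule ℝ A, IsSubalg m U → Module.finrank ℝ U = 2 → e ∈ U

/-- `one` is an identity element for `m` and for every `x` the elements
`one, x, x²` are linearly dependent. -/
def IsQuadraticWith (m : A →ₗ[ℝ] A →ₗ[ℝ] A) (one : A) : Prop :=
  (∀ x : A, m one x = x ∧ m x one = x) ∧
    ∀ x : A, ¬ LinearIndependent ℝ ![one, x, m x x]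

/-- A quadratic algebra: unital, and `1, x, x²` linearly dependent for all `x`. -/
def IsQuadratic (m : A →ₗ[ℝ] A →ₗ[ℝ] A) : Prop :=
  ∃ one : A, IsQuadraticWith m one

/-- The isotope multiplication `x ∘ y = (T x)·(T y)`. -/
def isotope (m : A →ₗ[ℝ] A →ₗ[ℝ] A) (T : A →ₗ[ℝ] A) : A →ₗ[ℝ] A →ₗ[ℝ] A :=
  (m.compl₂ T).comp T

/-- A planar map on a quadratic division algebra with identity `one`:
invertible, fixes `one`, and leaves every subalgebra invariant. -/
def Planar (m : A →ₗ[ℝ] A →ₗ[ℝ] A) (one : A) (T : A →ₗ[ℝ] A) : Prop :=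
  Function.Bijective T ∧ T one = one ∧
    ∀ U : Submodule ℝ A, IsSubalg m U → ∀ x ∈ U, T x ∈ U

/-- The imaginary space `Im B = {x ∉ ℝ·1 : x² ∈ ℝ·1} ∪ {0}` of a quadratic algebra. -/
def ImSet (m : A →ₗ[ℝ] A →ₗ[ℝ] A) (one : A) : Set A :=
  {x : A | x ∉ Submodule.span ℝ {one} ∧ m x x ∈ Submodule.span ℝ {one}} ∪ {0}

/-- The centraliser `C(e) = {y : e·y = y·e}`, a linear subspace. -/
def centraliser (m : A →ₗ[ℝ] A →ₗ[ℝ] A) (e : A) : Submodule ℝ A :=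
  LinearMap.ker (m e - m.flip e)

/-- An exceptional idempotent of a four-dimensional algebra: its centraliser is
three-dimensional and closed under squaring. -/
def Exceptional (m : A →ₗ[ℝ] A →ₗ[ℝ] A) (e : A) : Prop :=
  Module.finrank ℝ (centraliser m e) = 3 ∧
    ∀ x ∈ centraliser m e, m x x ∈ centraliser m e

end Defs

theorem Polynomial.exists_isRoot_of_odd_natDegree_real {p : Polynomial ℝ} (hp : p.Monic)
    (hodd : Odd p.natDegree) : ∃ x, p.IsRoot x := by
  by_contra! h
  have h₁ := p.zero_lt_eval_of_roots_lt_of_leadingCoeff_nonneg (x := 0)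
    (fun y hy ↦ absurd hy (h y)) (by simp [hp.leadingCoeff])
  have h₂ := p.zero_lt_negOnePow_mul_eval_of_lt_roots_of_leadingCoeff_nonneg (x := 0)
    (fun y hy ↦ absurd hy (h y)) (by simp [hp.leadingCoeff])
  rw [Int.negOnePow_odd _ (by exact_mod_cast hodd)] at h₂
  push_cast at h₂
  linarith

theorem exists_eq_smul_of_odd_finrank {A : Type*} [AddCommGroup A] [Module ℝ A]
    [FiniteDimensional ℝ A] {m : A →ₗ[ℝ] A →ₗ[ℝ] A} (hm : ∀ x y, m x y = 0 → x = 0 ∨ y = 0)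
    {V : Submodule ℝ A} (hV : Odd (finrank ℝ V)) {x y : A} (hy : y ≠ 0)
    (hxV : ∀ v ∈ V, m x v ∈ V) (hyV : ∀ v ∈ V, m y v ∈ V) : ∃ μ : ℝ, x = μ • y := by
  let S : End ℝ V := (m x).restrict hxV
  let T : End ℝ V := (m y).restrict hyV
  have hT : Function.Injective T := by
    rw [← LinearMap.ker_eq_bot, LinearMap.ker_eq_bot']
    intro v hv
    have := congrArg Subtype.val hv
    exact Subtype.ext ((hm y v this).resolve_left hy)
  let e := LinearEquiv.ofInjectiveEndo T hT
  obtain ⟨μ, hμ⟩ := Polynomial.exists_isRoot_of_odd_natDegree_real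
    (LinearMap.charpoly_monic (S ∘ₗ e.symm.toLinearMap))
    (by rwa [LinearMap.charpoly_natDegree])
  rw [← Module.End.hasEigenvalue_iff_isRoot_charpoly] at hμ
  obtain ⟨w, hw⟩ := hμ.exists_hasEigenvector
  have h₁ := hw.apply_eq_smul
  have hw0 := hw.2
  obtain ⟨v, rfl⟩ := e.surjective w
  have hTv : e v = T v := rfl
  simp only [LinearMap.comp_apply, LinearEquiv.coe_coe, LinearEquiv.symm_apply_apply] at h₁
  rw [hTv] at h₁
  have h₂ : m x v = μ • m y v := congrArg Subtype.val h₁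
  refine ⟨μ, sub_eq_zero.1 ((hm (x - μ • y) v (by simp [h₂])).resolve_right fun hv ↦ hw0 ?_)⟩
  rw [show v = 0 from Subtype.ext hv, map_zero]

section Covering

variable {E : Type*} [NormedAddCommGroup E] [NormedSpace ℝ E] [FiniteDimensional ℝ E]
  {B : E →L[ℝ] E →L[ℝ] E}

theorem eq_or_eq_neg_of_bilin_self_eq {E : Type*} [AddCommGroup E] [Module ℝ E]
    {m : E →ₗ[ℝ] E →ₗ[ℝ] E} (hm : ∀ x y, m x y = 0 → x = 0 ∨ y = 0)
    (hcomm : ∀ x y, m x y = m y x) {x y : E} (h : m x x = m y y) : x = y ∨ x = -y := by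
  have : m (x - y) (x + y) = 0 := by
    simp only [map_sub, map_add, LinearMap.sub_apply, h, hcomm x y]; abel
  rcases hm _ _ this with h | h
  · exact .inl (sub_eq_zero.1 h)
  · exact .inr (eq_neg_of_add_eq_zero_left h)

theorem isClosedMap_bilin_self (hB : ∀ x, B x x = 0 → x = 0) :
    IsClosedMap fun x ↦ B x x := by
  have : ProperSpace E := FiniteDimensional.proper_real E
  obtain ⟨c, hc, hcB⟩ := (isCompact_sphere (0 : E) 1).exists_forall_le' (a := 0)
    (f := fun x ↦ ‖B x x‖) (by fun_prop) fun x hx ↦ norm_pos_iff.2 fun h ↦ by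
      simp [hB x h] at hx
  have key (x : E) : c * ‖x‖ ^ 2 ≤ ‖B x x‖ := by
    rcases eq_or_ne x 0 with rfl | hx
    · simp
    have hx' : ‖x‖ ≠ 0 := norm_ne_zero_iff.2 hx
    have := hcB (‖x‖⁻¹ • x) (by simp [norm_smul, hx'])
    simp only [map_smul, smul_apply, norm_smul, norm_inv, norm_norm] at this
    calc c * ‖x‖ ^ 2 ≤ ‖x‖⁻¹ * (‖x‖⁻¹ * ‖B x x‖) * ‖x‖ ^ 2 := by gcongr
      _ = ‖B x x‖ := by field_simp
  refine IsProperMap.isClosedMap (isProperMap_iff_tendsto_cocompact.2 ⟨by fun_prop, ?_⟩)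
  rw [← Metric.cobounded_eq_cocompact, ← tendsto_norm_atTop_iff_cobounded]
  refine Filter.tendsto_atTop_mono key (Filter.Tendsto.const_mul_atTop hc ?_)
  exact (Filter.tendsto_pow_atTop two_ne_zero).comp tendsto_norm_cobounded_atTop

theorem isLocalHomeomorphOn_bilin_self (hB : ∀ x y, B x y = 0 → x = 0 ∨ y = 0)
    (hcomm : ∀ x y, B x y = B y x) :
    IsLocalHomeomorphOn (fun x ↦ B x x) {0}ᶜ := by
  have : CompleteSpace E := FiniteDimensional.complete ℝ E
  intro x hx
  have hinj : Function.Injective ((2 : ℝ) • B x).toLinearMap := by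
    rw [← LinearMap.ker_eq_bot, LinearMap.ker_eq_bot']
    intro v hv
    have : B x v = 0 := by simpa using hv
    exact (hB x v this).resolve_left hx
  let e : E ≃L[ℝ] E := (LinearEquiv.ofInjectiveEndo _ hinj).toContinuousLinearEquiv
  have hd : HasStrictFDerivAt (fun x ↦ B x x) (e : E →L[ℝ] E) x := by
    refine ((B.hasStrictFDerivAt (x := x)).clm_apply (hasStrictFDerivAt_id x)).congr_fderiv ?_
    apply ContinuousLinearMap.ext
    intro v
    have : e v = (2 : ℝ) • B x v := rfl
    simp [this, two_smul, hcomm v x]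
  exact ⟨_, hd.mem_toOpenPartialHomeomorph_source, by simp⟩

theorem isCoveringMapOn_bilin_self (hB : ∀ x y, B x y = 0 → x = 0 ∨ y = 0)
    (hcomm : ∀ x y, B x y = B y x) :
    IsCoveringMapOn (fun x ↦ B x x) {0}ᶜ := by
  refine (isClosedMap_bilin_self fun x hx ↦ (or_self_iff.1 (hB x x hx))
    ).isCoveringMapOn_of_isLocalHomeomorphOn (fun z _ ↦ ?_)
    ((isLocalHomeomorphOn_bilin_self hB hcomm).mono fun x hx h ↦ hx (by
      rw [Set.mem_singleton_iff] at h ⊢; simp [h]))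
  rcases (((fun x ↦ B x x) ⁻¹' {z})).eq_empty_or_nonempty with h | ⟨y, hy⟩
  · simp [h]
  · refine (Set.toFinite {y, -y}).subset fun x hx ↦ ?_
    exact eq_or_eq_neg_of_bilin_self_eq (m := B.toLinearMap₁₂) hB hcomm (hx.trans hy.symm)

theorem not_linearIndependent_bilin_products (hB : ∀ x y, B x y = 0 → x = 0 ∨ y = 0)
    (hcomm : ∀ x y, B x y = B y x) (x y : E) :
    ¬ LinearIndependent ℝ ![B x x, B x y, B y y] := by
  intro hli
  rw [Fintype.linearIndependent_iff] at hli
  have hx : x ≠ 0 := by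
    rintro rfl
    simpa using hli ![1, 0, 0] (by simp [Fin.sum_univ_three]) 0
  let F : C(ℝ × ℝ, E) := ⟨fun p ↦ ((1 + p.1) / 2) • B x x + p.2 • B x y +
    ((1 - p.1) / 2) • B y y, by fun_prop⟩
  have hF (p : ℝ × ℝ) : F p ∈ ({0}ᶜ : Set E) := by
    intro h
    have h' := hli ![(1 + p.1) / 2, p.2, (1 - p.1) / 2] (by
      rw [Fin.sum_univ_three]; exact h)
    have h0 := h' 0
    have h2 := h' 2
    simp at h0 h2
    linarith
  have cov := isCoveringMapOn_bilin_self hB hcomm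
  have hx1 : (fun x ↦ B x x) x = F (1, 0) := by simp [F]
  obtain ⟨G, ⟨hG₁, hG₂⟩, -⟩ := cov.existsUnique_continuousMap_lifts F hx1 hF
  let γ : C(ℝ, ℝ × ℝ) := ⟨fun t ↦ (Real.cos (2 * t), Real.sin (2 * t)), by fun_prop⟩
  let H : C(ℝ, E) := ⟨fun t ↦ Real.cos t • x + Real.sin t • y, by fun_prop⟩
  have hγ : γ 0 = (1, 0) := by simp [γ]
  have hγπ : γ Real.pi = (1, 0) := by simp [γ]
  have hH : (fun x ↦ B x x) ∘ H = F.comp γ := by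
    ext t
    have h₁ : (1 + Real.cos (2 * t)) / 2 = Real.cos t * Real.cos t := by
      rw [Real.cos_two_mul]; ring
    have h₂ : (1 - Real.cos (2 * t)) / 2 = Real.sin t * Real.sin t := by
      rw [Real.cos_two_mul]; linear_combination - Real.sin_sq_add_cos_sq t
    simp only [Function.comp_apply, ContinuousMap.comp_apply, ContinuousMap.coe_mk, F, γ, H, h₁,
      h₂, Real.sin_two_mul, map_add, map_smul, add_apply,
      smul_apply, hcomm y x]
    module
  have huniq := cov.existsUnique_continuousMap_lifts (F.comp γ) (a₀ := 0) (e₀ := x)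
    (by simp [hγ, F]) (fun t ↦ hF _)
  have heq : G.comp γ = H := huniq.unique ⟨by simp [hγ, hG₁], by
    rw [ContinuousMap.coe_comp, ← Function.comp_assoc, hG₂, ContinuousMap.coe_comp]⟩
    ⟨by simp [H], hH⟩
  have h₁ : H Real.pi = x := by rw [← heq, ContinuousMap.comp_apply, hγπ, hG₁]
  have h₂ : H Real.pi = -x := by simp [H]
  have h₃ : (2 : ℝ) • x = 0 := by
    rw [two_smul]
    exact eq_neg_iff_add_eq_zero.1 (h₁.symm.trans h₂)
  exact hx ((smul_eq_zero.1 h₃).resolve_left two_ne_zero)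

end Covering

theorem not_linearIndependent_products {U : Type*} [AddCommGroup U] [Module ℝ U]
    [FiniteDimensional ℝ U] {m : U →ₗ[ℝ] U →ₗ[ℝ] U} (hm : ∀ x y, m x y = 0 → x = 0 ∨ y = 0)
    (hcomm : ∀ x y, m x y = m y x) (x y : U) :
    ¬ LinearIndependent ℝ ![m x x, m x y, m y y] := by
  intro hli
  let e := (finBasis ℝ U).equivFun
  let B := ((m.compl₁₂ e.symm.toLinearMap e.symm.toLinearMap).compr₂
    e.toLinearMap).toContinuousBilinearMap
  have hBe (a b : U) : B (e a) (e b) = e (m a b) := by simp [B]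
  refine not_linearIndependent_bilin_products (B := B) (fun a b h ↦ ?_) (fun a b ↦ ?_)
    (e x) (e y) ?_
  · obtain ⟨a, rfl⟩ := e.surjective a
    obtain ⟨b, rfl⟩ := e.surjective b
    simpa [hBe] using hm a b (by simpa [hBe] using h)
  · obtain ⟨a, rfl⟩ := e.surjective a
    obtain ⟨b, rfl⟩ := e.surjective b
    rw [hBe, hBe, hcomm]
  · have h := hli.map' e.toLinearMap e.ker
    have heq : ![B (e x) (e x), B (e x) (e y), B (e y) (e y)] =
        e.toLinearMap ∘ ![m x x, m x y, m y y] := by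
      ext i : 1
      fin_cases i <;> simp [hBe]
    exact heq ▸ h

/-- **Hopf's theorem**: a commutative real division algebra has dimension at most two. -/
theorem not_linearIndependent_triple_of_comm {U : Type*} [AddCommGroup U] [Module ℝ U]
    [FiniteDimensional ℝ U] {m : U →ₗ[ℝ] U →ₗ[ℝ] U} (hm : ∀ x y, m x y = 0 → x = 0 ∨ y = 0)
    (hcomm : ∀ x y, m x y = m y x) (u v w : U) : ¬ LinearIndependent ℝ ![u, v, w] := by
  intro hli
  rw [Fintype.linearIndependent_iff] at hli
  have hind (a b c : ℝ) (h : a • u + b • v + c • w = 0) : a = 0 ∧ b = 0 ∧ c = 0 := by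
    have := hli ![a, b, c] (by rw [Fin.sum_univ_three]; exact h)
    exact ⟨this 0, this 1, this 2⟩
  have hu : u ≠ 0 := by
    rintro rfl
    simpa using hind 1 0 0 (by simp)
  have hsq (y : U) : ∃ a b : ℝ, m y y = m u (a • u + b • y) := by
    have h := not_linearIndependent_products hm hcomm u y
    rw [Fintype.not_linearIndependent_iff] at h
    obtain ⟨p, q, r, hg, hne⟩ : ∃ p q r : ℝ, p • m u u + q • m u y + r • m y y = 0 ∧
        ¬ (p = 0 ∧ q = 0 ∧ r = 0) := by
      obtain ⟨g, hg, i, hi⟩ := h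
      rw [Fin.sum_univ_three] at hg
      refine ⟨g 0, g 1, g 2, hg, fun ⟨h0, h1, h2⟩ ↦ hi ?_⟩
      fin_cases i
      exacts [h0, h1, h2]
    by_cases hr : r = 0
    · have h0 : m u (p • u + q • y) = 0 := by simpa [hr] using hg
      replace h0 := (hm _ _ h0).resolve_left hu
      have hq : q ≠ 0 := by
        rintro rfl
        exact hne ⟨by simpa [hu] using h0, rfl, hr⟩
      obtain rfl : y = (-q⁻¹ * p) • u := by
        rw [← inv_smul_smul₀ hq y, eq_neg_of_add_eq_zero_right h0]
        module
      exact ⟨(-q⁻¹ * p) ^ 2, 0, by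
        simp only [map_smul, LinearMap.smul_apply, zero_smul, add_zero]; module⟩
    · refine ⟨-r⁻¹ * p, -r⁻¹ * q, ?_⟩
      rw [← inv_smul_smul₀ hr (m y y), eq_neg_of_add_eq_zero_right hg, map_add, map_smul, map_smul]
      module
  have hshift (y : U) : ∃ a b : ℝ, m (y + b • u) (y + b • u) = a • m u u := by
    obtain ⟨a, b, h⟩ := hsq y
    refine ⟨a + b ^ 2 / 4, -(b / 2), ?_⟩
    simp only [map_add, map_smul, LinearMap.add_apply, LinearMap.smul_apply, hcomm y u] at h ⊢
    rw [h]
    module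
  obtain ⟨a, b, hv⟩ := hshift v
  obtain ⟨c, d, hw⟩ := hshift w
  obtain ⟨a₁, b₁, h₁⟩ := hsq ((v + b • u) + (w + d • u))
  obtain ⟨a₂, b₂, h₂⟩ := hsq ((v + b • u) - (w + d • u))
  set v' := v + b • u with hv'
  set w' := w + d • u with hw'
  have hind' (p q r : ℝ) (h : p • u + q • v' + r • w' = 0) : q = 0 ∧ r = 0 :=
    (hind (p + q * b + r * d) q r (by rw [← h, hv', hw']; module)).2
  have hsum : m u ((a₁ + a₂ - 2 * a - 2 * c) • u + (b₁ + b₂) • v' + (b₁ - b₂) • w') = 0 := by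
    simp only [map_add, map_sub, map_smul, LinearMap.add_apply, LinearMap.sub_apply,
      hcomm w' v'] at h₁ h₂ ⊢
    linear_combination (norm := module) (2 : ℝ) • hv + (2 : ℝ) • hw - h₁ - h₂
  obtain ⟨hp, hq⟩ := hind' _ _ _ ((hm _ _ hsum).resolve_left hu)
  obtain rfl : b₁ = 0 := by linarith
  have hvw : m v' w' = ((a₁ - a - c) / 2) • m u u := by
    simp only [map_add, map_smul, LinearMap.add_apply, hcomm w' v', zero_smul, map_zero] at h₁
    linear_combination (norm := module) (1 / 2 : ℝ) • (h₁ - hv - hw)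
  have hv0 : v' ≠ 0 := fun h ↦ by simpa using (hind' 0 1 0 (by simp [h])).1
  have hprod : m v' (a • w' - ((a₁ - a - c) / 2) • v') = 0 := by
    simp only [map_sub, map_smul, hv, hvw]
    module
  have ha : a = 0 := (hind' 0 (-((a₁ - a - c) / 2)) a (by
    rw [← (hm _ _ hprod).resolve_left hv0]; module)).2
  rw [ha, zero_smul] at hv
  exact hv0 (or_self_iff.1 (hm _ _ hv))

section PowerCommutative

variable {A : Type*} [AddCommGroup A] [Module ℝ A] {m : A →ₗ[ℝ] A →ₗ[ℝ] A}

theorem IsDivision.eq_zero_or_eq_zero (hdiv : IsDivision m) (x y : A) (h : m x y = 0) :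
    x = 0 ∨ y = 0 := by
  refine or_iff_not_imp_left.2 fun hx ↦ (hdiv x hx).1.1 ?_
  simpa using h

theorem self_mem_genSubalg (m : A →ₗ[ℝ] A →ₗ[ℝ] A) (x : A) : x ∈ genSubalg m {x} :=
  (Submodule.mem_sInf).2 fun _ hU ↦ hU.2 rfl

theorem isSubalg_genSubalg (m : A →ₗ[ℝ] A →ₗ[ℝ] A) (s : Set A) : IsSubalg m (genSubalg m s) :=
  fun x hx y hy ↦ (Submodule.mem_sInf).2 fun U hU ↦
    hU.1 x ((Submodule.mem_sInf).1 hx U hU) y ((Submodule.mem_sInf).1 hy U hU)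

theorem finrank_span_triple {u v w : A} (h : LinearIndependent ℝ ![u, v, w]) :
    finrank ℝ (Submodule.span ℝ {u, v, w}) = 3 := by
  have := finrank_span_eq_card h
  rwa [Matrix.range_cons, Matrix.range_cons_cons_empty, Set.singleton_union,
    Fintype.card_fin] at this

theorem span_triple_stable {x u v w : A} {V : Submodule ℝ A} (hu : m x u ∈ V) (hv : m x v ∈ V)
    (hw : m x w ∈ V) : ∀ y ∈ Submodule.span ℝ {u, v, w}, m x y ∈ V := by
  have : Submodule.span ℝ {u, v, w} ≤ V.comap (m x) := by
    rw [Submodule.span_le]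
    rintro _ (rfl | rfl | rfl)
    exacts [hu, hv, hw]
  exact this

variable [FiniteDimensional ℝ A]

theorem not_linearIndependent_of_mem_genSubalg (hm : ∀ x y, m x y = 0 → x = 0 ∨ y = 0)
    (hpc : PowerComm m) {x u v w : A} (hu : u ∈ genSubalg m {x}) (hv : v ∈ genSubalg m {x})
    (hw : w ∈ genSubalg m {x}) : ¬ LinearIndependent ℝ ![u, v, w] := by
  intro hli
  let U := genSubalg m {x}
  let m' : U →ₗ[ℝ] U →ₗ[ℝ] U := LinearMap.mk₂ ℝ
    (fun a b ↦ ⟨m a b, isSubalg_genSubalg m {x} a a.2 b b.2⟩)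
    (fun _ _ _ ↦ Subtype.ext (by simp)) (fun _ _ _ ↦ Subtype.ext (by simp))
    (fun _ _ _ ↦ Subtype.ext (by simp)) (fun _ _ _ ↦ Subtype.ext (by simp))
  refine not_linearIndependent_triple_of_comm (m := m') (fun a b h ↦ ?_)
    (fun a b ↦ Subtype.ext (hpc x a a.2 b b.2)) ⟨u, hu⟩ ⟨v, hv⟩ ⟨w, hw⟩ ?_
  · simpa using hm a b (congrArg Subtype.val h)
  · refine LinearIndependent.of_comp U.subtype ?_
    convert hli using 1
    ext i : 1
    fin_cases i <;> rfl

theorem not_linearIndependent_of_stable (hm : ∀ x y, m x y = 0 → x = 0 ∨ y = 0) {u v w : A}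
    (hu : ∀ y ∈ Submodule.span ℝ {u, v, w}, m u y ∈ Submodule.span ℝ {u, v, w})
    (hv : ∀ y ∈ Submodule.span ℝ {u, v, w}, m v y ∈ Submodule.span ℝ {u, v, w}) :
    ¬ LinearIndependent ℝ ![u, v, w] := by
  intro hli
  have hV : Odd (finrank ℝ (Submodule.span ℝ {u, v, w})) := by
    rw [finrank_span_triple hli]
    decide
  obtain ⟨μ, hμ⟩ := exists_eq_smul_of_odd_finrank hm hV (hli.ne_zero 1) hu hv
  have hμ' : u = μ • v := hμ
  have := Fintype.linearIndependent_iff.1 hli ![1, -μ, 0]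
    (by rw [Fin.sum_univ_three]; simp [hμ']) 0
  simp at this

theorem mul_mem_span_pair_of_idempotent (hm : ∀ x y, m x y = 0 → x = 0 ∨ y = 0)
    (hpc : PowerComm m) {e f : A} (he : m e e = e) (hf : m f f = f) (hef : m e f = m f e) :
    m e f ∈ Submodule.span ℝ {e, f} := by
  by_cases hli : LinearIndependent ℝ ![e, f]
  swap
  · have hdep : ∃ a b : ℝ, a • e + b • f = 0 ∧ ¬ (a = 0 ∧ b = 0) := by
      rw [LinearIndependent.pair_iff] at hli
      push Not at hli
      obtain ⟨a, b, h, hab⟩ := hli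
      exact ⟨a, b, h, fun h' ↦ hab h'.1 h'.2⟩
    obtain ⟨a, b, h, hab⟩ := hdep
    by_cases ha : a = 0
    · have hb : b ≠ 0 := fun hb ↦ hab ⟨ha, hb⟩
      have hf0 : f = 0 := by simpa [ha, hb] using h
      simp [hf0]
    · have he' : e = (-a⁻¹ * b) • f := by
        rw [← inv_smul_smul₀ ha e, eq_neg_of_add_eq_zero_left h]
        module
      rw [he', map_smul, LinearMap.smul_apply, hf, ← he']
      exact Submodule.subset_span (by simp)
  by_contra hg
  rw [LinearIndependent.pair_iff] at hli
  set g := m e f with hgdef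
  have hind (a b c : ℝ) (h : a • e + b • f + c • g = 0) : a = 0 ∧ b = 0 ∧ c = 0 := by
    have hc : c = 0 := by
      by_contra hc
      refine hg (Submodule.mem_span_pair.2 ⟨-c⁻¹ * a, -c⁻¹ * b, ?_⟩)
      rw [← inv_smul_smul₀ hc g, eq_neg_of_add_eq_zero_right h]
      module
    subst hc
    have := hli a b (by simpa using h)
    exact ⟨this.1, this.2, rfl⟩
  have hli3 : LinearIndependent ℝ ![e, f, g] := by
    rw [Fintype.linearIndependent_iff]
    intro c hc i
    rw [Fin.sum_univ_three] at hc
    obtain ⟨h0, h1, h2⟩ := hind _ _ _ hc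
    fin_cases i
    exacts [h0, h1, h2]
  let V := Submodule.span ℝ {e, f, g}
  have heV : e ∈ V := Submodule.subset_span (by simp)
  have hfV : f ∈ V := Submodule.subset_span (by simp)
  have hgV : g ∈ V := Submodule.subset_span (by simp)
  have key (t : ℝ) (ht : t ≠ 0) : m e g + t • m f g ∈ V := by
    set x := e + t • f with hx
    have hxx : m x x = e + t ^ 2 • f + (2 * t) • g := by
      simp only [hx, map_add, map_smul, LinearMap.add_apply, LinearMap.smul_apply, he, hf, ← hef,
        ← hgdef]
      module
    have hxxx : m x (m x x) = e + t ^ 3 • f + (t + t ^ 2) • g + (2 * t) • (m e g + t • m f g) := by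
      rw [hxx]
      simp only [hx, map_add, map_smul, LinearMap.add_apply, LinearMap.smul_apply, he, hf, ← hef,
        ← hgdef]
      module
    have hxU := self_mem_genSubalg m x
    have hxxU := isSubalg_genSubalg m {x} x hxU x hxU
    have hdep := not_linearIndependent_of_mem_genSubalg hm hpc hxU hxxU
      (isSubalg_genSubalg m {x} x hxU _ hxxU)
    rw [Fintype.not_linearIndependent_iff] at hdep
    obtain ⟨c, hc, i, hi⟩ := hdep
    rw [Fin.sum_univ_three] at hc
    change c 0 • x + c 1 • m x x + c 2 • m x (m x x) = 0 at hc
    have hc2 : c 2 ≠ 0 := by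
      intro hc2
      obtain ⟨h0, -, h1⟩ := hind (c 0 + c 1) (c 0 * t + c 1 * t ^ 2) (c 1 * (2 * t)) (by
        rw [← hc, hc2, hxx, hx]
        module)
      have h1' : c 1 = 0 := by simpa [ht] using h1
      have h0' : c 0 = 0 := by simpa [h1'] using h0
      fin_cases i
      exacts [hi h0', hi h1', hi hc2]
    have hxxxV : m x (m x x) ∈ V := by
      rw [← inv_smul_smul₀ hc2 (m x (m x x)), eq_neg_of_add_eq_zero_right hc, hxx, hx]
      have := V.add_mem (V.add_mem (V.smul_mem (-(c 2)⁻¹ * (c 0 + c 1)) heV)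
        (V.smul_mem (-(c 2)⁻¹ * (c 0 * t + c 1 * t ^ 2)) hfV))
        (V.smul_mem (-(c 2)⁻¹ * (c 1 * (2 * t))) hgV)
      convert this using 1
      module
    rw [hxxx] at hxxxV
    have hsum : e + t ^ 3 • f + (t + t ^ 2) • g ∈ V :=
      V.add_mem (V.add_mem heV (V.smul_mem _ hfV)) (V.smul_mem _ hgV)
    exact (V.smul_mem_iff (by simpa using ht)).1 ((V.add_mem_iff_right hsum).1 hxxxV)
  have h₁ := key 1 one_ne_zero
  have h₂ := key 2 two_ne_zero
  have hfg : m f g ∈ V := by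
    convert V.sub_mem h₂ h₁ using 1
    module
  have heg : m e g ∈ V := by
    convert V.sub_mem h₁ hfg using 1
    module
  exact not_linearIndependent_of_stable hm
    (span_triple_stable (by rwa [he]) hgV heg)
    (span_triple_stable (by rwa [← hef]) (by rwa [hf]) hfg) hli3

theorem not_linearIndependent_of_commuting_idempotents
    (hm : ∀ x y, m x y = 0 → x = 0 ∨ y = 0) (hpc : PowerComm m) {s : Set A}
    (hidem : ∀ e ∈ s, m e e = e) (hcomm : ∀ e ∈ s, ∀ f ∈ s, m e f = m f e) {u v w : A}
    (hu : u ∈ s) (hv : v ∈ s) (hw : w ∈ s) : ¬ LinearIndependent ℝ ![u, v, w] := by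
  have key {a b : A} (ha : a ∈ s) (hb : b ∈ s) (ha' : a ∈ ({u, v, w} : Set A))
      (hb' : b ∈ ({u, v, w} : Set A)) : m a b ∈ Submodule.span ℝ {u, v, w} :=
    Submodule.span_mono (Set.pair_subset ha' hb')
      (mul_mem_span_pair_of_idempotent hm hpc (hidem a ha) (hidem b hb) (hcomm a ha b hb))
  exact not_linearIndependent_of_stable hm
    (span_triple_stable (key hu hu (by simp) (by simp)) (key hu hv (by simp) (by simp))
      (key hu hw (by simp) (by simp)))
    (span_triple_stable (key hv hu (by simp) (by simp)) (key hv hv (by simp) (by simp))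
      (key hv hw (by simp) (by simp)))

end PowerCommutative

/-- In a finite-dimensional power-commutative real division algebra,
every set of mutually commuting idempotents spans a commutative subalgebra; in
particular at most two linearly independent idempotents commute with each other. -/
theorem stmt_5 {A : Type*} [AddCommGroup A] [Module ℝ A] [FiniteDimensional ℝ A]
    (m : A →ₗ[ℝ] A →ₗ[ℝ] A) (hdiv : IsDivision m) (hpc : PowerComm m)
    (s : Set A) (hidem : ∀ e ∈ s, m e e = e)
    (hcomm : ∀ e ∈ s, ∀ f ∈ s, m e f = m f e) :
    IsSubalg m (Submodule.span ℝ s) ∧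
    (∀ a ∈ Submodule.span ℝ s, ∀ b ∈ Submodule.span ℝ s, m a b = m b a) ∧
    Module.finrank ℝ (Submodule.span ℝ s) ≤ 2 := by
  have hm := hdiv.eq_zero_or_eq_zero
  refine ⟨fun x hx y hy ↦ ?_, fun x hx y hy ↦ ?_, ?_⟩
  · induction hx, hy using Submodule.span_induction₂ with
    | mem_mem e f he hf =>
      exact Submodule.span_mono (Set.pair_subset he hf) (mul_mem_span_pair_of_idempotent hm hpc
        (hidem e he) (hidem f hf) (hcomm e he f hf))
    | zero_left => simp
    | zero_right => simp
    | add_left x y z _ _ _ h₁ h₂ => simpa using add_mem h₁ h₂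
    | add_right x y z _ _ _ h₁ h₂ => simpa using add_mem h₁ h₂
    | smul_left r x y _ _ h => simpa using Submodule.smul_mem _ r h
    | smul_right r x y _ _ h => simpa using Submodule.smul_mem _ r h
  · induction hx, hy using Submodule.span_induction₂ with
    | mem_mem e f he hf => exact hcomm e he f hf
    | zero_left => simp
    | zero_right => simp
    | add_left x y z _ _ _ h₁ h₂ => simp [h₁, h₂]
    | add_right x y z _ _ _ h₁ h₂ => simp [h₁, h₂]
    | smul_left r x y _ _ h => simp [h]
    | smul_right r x y _ _ h => simp [h]
  · by_contra! h
    obtain ⟨b, hb, -, hli⟩ := Submodule.exists_fun_fin_finrank_span_eq ℝ s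
    let ι : Fin 3 → Fin (finrank ℝ (Submodule.span ℝ s)) := Fin.castLE h
    refine not_linearIndependent_of_commuting_idempotents hm hpc hidem hcomm (hb (ι 0))
      (hb (ι 1)) (hb (ι 2)) ?_
    have hι : ![b (ι 0), b (ι 1), b (ι 2)] = b ∘ ι := by
      ext i : 1
      fin_cases i <;> rfl
    rw [hι]
    exact hli.comp ι (Fin.castLE_injective h)
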